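/- Let s > -1. There exist constants 0 < c < C < ∞ depending only on s such that for all integers p, q ≥ 1: c ≤ [∫₀¹ t^{p+q-1}(1-t)^s ₂F₁(p,q;p+q;t)² dt] · Γ(p)Γ(q)Γ(p+s+1)Γ(q+s+1) / Γ(p+q)² ≤ C. -/

import Mathlib

open MeasureTheory ENNReal NNReal

/-- Pochhammer symbol `(a)_k = Γ(a+k)/Γ(a)`. -/
noncomputable def poch (a : ℝ) (k : ℕ) : ℝ := Real.Gamma (a + k) / Real.Gamma a

/-- Gauss hypergeometric function `₂F₁(a,b;c;t)`, as a sum of its series. -/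
noncomputable def hyp2F1 (a b c t : ℝ) : ℝ :=
  ∑' k : ℕ, (poch a k * poch b k) / (poch c k * (Nat.factorial k)) * t ^ k

/-- `S_pq(t)`. -/
noncomputable def Spq (n p q : ℕ) (t : ℝ) : ℝ :=
  (Real.Gamma (n + p) * Real.Gamma (n + q)) / (Real.Gamma n * Real.Gamma ((n : ℝ) + p + q)) *
    hyp2F1 p q ((p : ℝ) + q + n) t

/-- `c_pq(s)`. -/
noncomputable def cpq (n p q : ℕ) (s : ℝ) : ℝ :=
  poch (s + 1) n / Real.Gamma n *
    ∫ t in Set.Ioo (0:ℝ) 1, t ^ ((p : ℝ) + q + n - 1) * (1 - t) ^ s * (Spq n p q t) ^ 2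

/-- The ratio `Γ(x) / Γ(x + σ)`, comparable to `x ^ (-σ)`. -/
noncomputable def gammaRatio (σ x : ℝ) : ℝ := Real.Gamma x / Real.Gamma (x + σ)

/-- The Taylor coefficients of `B(p, q) ₂F₁(p, q; p + q; t)`. -/
noncomputable def hypCoeff (p q : ℝ) (k : ℕ) : ℝ :=
  Real.Gamma (p + k) * Real.Gamma (q + k) / (Real.Gamma (p + q + k) * k.factorial)

lemma gammaRatio_pos {σ x : ℝ} (hσ : 0 < σ) (hx : 0 < x) : 0 < gammaRatio σ x :=
  div_pos (Real.Gamma_pos_of_pos hx) (Real.Gamma_pos_of_pos (by positivity))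

lemma hypCoeff_pos {p q : ℝ} (hp : 0 < p) (hq : 0 < q) (k : ℕ) : 0 < hypCoeff p q k :=
  div_pos (mul_pos (Real.Gamma_pos_of_pos (by positivity)) (Real.Gamma_pos_of_pos (by positivity)))
    (mul_pos (Real.Gamma_pos_of_pos (by positivity)) (by positivity))

lemma Gamma_add_sq_le {x σ : ℝ} (hx : 0 < x) (hσ : 0 < σ) :
    Real.Gamma (x + σ) ^ 2 ≤ Real.Gamma x * Real.Gamma (x + 2 * σ) := by
  have h := Real.Gamma_mul_add_mul_le_rpow_Gamma_mul_rpow_Gamma hx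
    (show 0 < x + 2 * σ by positivity) (show (0 : ℝ) < 1 / 2 by norm_num)
    (show (0 : ℝ) < 1 / 2 by norm_num) (by norm_num)
  have h1 := Real.Gamma_pos_of_pos hx
  have h2 := Real.Gamma_pos_of_pos (show 0 < x + 2 * σ by positivity)
  have h3 := Real.Gamma_pos_of_pos (show 0 < x + σ by positivity)
  rw [show 1 / 2 * x + 1 / 2 * (x + 2 * σ) = x + σ by ring, ← Real.sqrt_eq_rpow,
    ← Real.sqrt_eq_rpow, ← Real.sqrt_mul h1.le] at h
  calc Real.Gamma (x + σ) ^ 2 ≤ √(Real.Gamma x * Real.Gamma (x + 2 * σ)) ^ 2 := by gcongr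
    _ = _ := Real.sq_sqrt (by positivity)

lemma gammaRatio_two_mul_le_sq {x σ : ℝ} (hx : 0 < x) (hσ : 0 < σ) :
    gammaRatio (2 * σ) x ≤ gammaRatio σ x ^ 2 := by
  have h := Gamma_add_sq_le hx hσ
  have h1 := Real.Gamma_pos_of_pos hx
  have h2 := Real.Gamma_pos_of_pos (show 0 < x + 2 * σ by positivity)
  have h3 := Real.Gamma_pos_of_pos (show 0 < x + σ by positivity)
  rw [gammaRatio, gammaRatio, div_pow, div_le_div_iff₀ h2 (by positivity)]
  nlinarith

lemma gammaRatio_add_one {x σ : ℝ} (hx : 0 < x) (hσ : 0 < σ) :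
    gammaRatio σ (x + 1) = x / (x + σ) * gammaRatio σ x := by
  rw [gammaRatio, gammaRatio, show x + 1 + σ = x + σ + 1 by ring, Real.Gamma_add_one hx.ne',
    Real.Gamma_add_one (by positivity), mul_div_mul_comm]

lemma gammaRatio_add_nat_le {x σ : ℝ} (hx : 0 < x) (hσ : 0 < σ) (k : ℕ) :
    gammaRatio σ (x + k) ≤ gammaRatio σ x := by
  induction k with
  | zero => simp
  | succ k ih =>
    have hk : 0 < x + k := by positivity
    rw [Nat.cast_succ, ← add_assoc, gammaRatio_add_one hk hσ]
    refine le_trans (mul_le_of_le_one_left (gammaRatio_pos hσ hk).le ?_) ih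
    rw [div_le_one (by positivity)]
    linarith

/-- `Γ(n) Γ(n + 2σ) / Γ(n + σ)²` is decreasing in the positive integer `n`. -/
lemma sq_gammaRatio_le {σ : ℝ} (hσ : 0 < σ) {n : ℕ} (hn : 1 ≤ n) :
    gammaRatio σ n ^ 2 ≤ gammaRatio σ 1 ^ 2 / gammaRatio (2 * σ) 1 * gammaRatio (2 * σ) n := by
  induction n, hn using Nat.le_induction with
  | base =>
    have := gammaRatio_pos (show 0 < 2 * σ by positivity) one_pos
    simp [this.ne']
  | succ n hn ih =>
    have hn' : (0 : ℝ) < n := by positivity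
    have h2 := gammaRatio_pos (show 0 < 2 * σ by positivity) hn'
    rw [Nat.cast_succ, gammaRatio_add_one hn' hσ, gammaRatio_add_one hn' (by positivity), mul_pow]
    calc _ ≤ (n / (n + 2 * σ)) * (gammaRatio σ 1 ^ 2 / gammaRatio (2 * σ) 1 *
          gammaRatio (2 * σ) n) := by
          gcongr
          rw [div_pow, div_le_div_iff₀ (by positivity) (by positivity)]
          nlinarith [mul_pos hn' (sq_pos_of_pos hσ)]
      _ = _ := by ring

lemma lintegral_rpow_mul_one_sub_rpow {a b : ℝ} (ha : 0 < a) (hb : 0 < b) :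
    ∫⁻ t in Set.Ioo (0 : ℝ) 1, ENNReal.ofReal (t ^ (a - 1) * (1 - t) ^ (b - 1)) =
      ENNReal.ofReal (Real.Gamma b * gammaRatio b a) := by
  have h := ProbabilityTheory.lintegral_betaPDF_eq_one ha hb
  have hB := ProbabilityTheory.beta_pos ha hb
  rw [ProbabilityTheory.lintegral_betaPDF] at h
  have h2 : Real.Gamma b * gammaRatio b a = ProbabilityTheory.beta a b := by
    rw [gammaRatio, ProbabilityTheory.beta]; ring
  simp_rw [mul_assoc] at h
  have h3 : ∀ t : ℝ, ENNReal.ofReal (1 / ProbabilityTheory.beta a b *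
      (t ^ (a - 1) * (1 - t) ^ (b - 1))) = ENNReal.ofReal (1 / ProbabilityTheory.beta a b) *
      ENNReal.ofReal (t ^ (a - 1) * (1 - t) ^ (b - 1)) := fun t =>
    ENNReal.ofReal_mul (by positivity)
  simp_rw [h3] at h
  rw [lintegral_const_mul' _ _ ENNReal.ofReal_ne_top] at h
  rw [h2]
  set I := ∫⁻ t in Set.Ioo (0 : ℝ) 1, ENNReal.ofReal (t ^ (a - 1) * (1 - t) ^ (b - 1))
  calc I = ENNReal.ofReal (ProbabilityTheory.beta a b) *
        (ENNReal.ofReal (1 / ProbabilityTheory.beta a b) * I) := by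
        rw [← mul_assoc, ← ENNReal.ofReal_mul hB.le, mul_one_div_cancel hB.ne']; simp
    _ = _ := by rw [h, mul_one]

/-- The negative binomial series. -/
lemma hasSum_Gamma_div_factorial {p : ℕ} (hp : 1 ≤ p) {u : ℝ} (hu : u ∈ Set.Ioo (0 : ℝ) 1) :
    HasSum (fun k : ℕ => Real.Gamma (p + k) / k.factorial * u ^ k)
      (Real.Gamma p * (1 - u) ^ (-(p : ℝ))) := by
  obtain ⟨m, rfl⟩ := Nat.exists_eq_add_of_le' hp
  have h := (hasSum_choose_mul_geometric_of_norm_lt_one m (r := u)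
    (by rw [Real.norm_of_nonneg hu.1.le]; exact hu.2)).mul_left (m.factorial : ℝ)
  have hu' : 0 < 1 - u := sub_pos.2 hu.2
  convert! h using 1
  · ext k
    rw [show ((m + 1 : ℕ) : ℝ) + k = ((k + m : ℕ) : ℝ) + 1 by push_cast; ring,
      Real.Gamma_nat_eq_factorial, add_comm k m, Nat.cast_add_choose]
    have := Nat.factorial_ne_zero m
    field_simp
  · rw [Real.rpow_neg hu'.le, Real.rpow_natCast]
    push_cast
    rw [Real.Gamma_nat_eq_factorial]
    ring

/-- Gauss's summation theorem, in the form needed for `₂F₁(p, q; p + q + σ; 1)`. -/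
lemma tsum_hypCoeff_mul_gammaRatio {p : ℕ} (hp : 1 ≤ p) {q σ : ℝ} (hq : 0 < q) (hσ : 0 < σ) :
    ∑' k : ℕ, ENNReal.ofReal (hypCoeff p q k * gammaRatio σ (p + q + k)) =
      ENNReal.ofReal (Real.Gamma σ * gammaRatio σ p * gammaRatio σ q) := by
  have hp' : (0 : ℝ) < p := by positivity
  have hpσ := Real.Gamma_pos_of_pos (show 0 < p + σ by positivity)
  have hterm : ∀ k : ℕ, ENNReal.ofReal (hypCoeff p q k * gammaRatio σ (p + q + k)) =
      ∫⁻ u in Set.Ioo (0 : ℝ) 1, ENNReal.ofReal (1 / Real.Gamma (p + σ)) *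
        ENNReal.ofReal (u ^ (q - 1) * (1 - u) ^ (p + σ - 1) *
          (Real.Gamma (p + k) / k.factorial * u ^ k)) := by
    intro k
    have hG := Real.Gamma_pos_of_pos (show 0 < (p : ℝ) + k by positivity)
    rw [lintegral_const_mul' _ _ ENNReal.ofReal_ne_top]
    have : ∀ u ∈ Set.Ioo (0 : ℝ) 1, ENNReal.ofReal (u ^ (q - 1) * (1 - u) ^ (p + σ - 1) *
          (Real.Gamma (p + k) / k.factorial * u ^ k)) =
        ENNReal.ofReal (Real.Gamma (p + k) / k.factorial) *
          ENNReal.ofReal (u ^ (q + k - 1) * (1 - u) ^ (p + σ - 1)) := by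
      intro u hu
      rw [← ENNReal.ofReal_mul (by positivity), show q + k - 1 = q - 1 + k by ring,
        Real.rpow_add hu.1, Real.rpow_natCast]
      congr 1
      ring
    rw [setLIntegral_congr_fun measurableSet_Ioo this,
      lintegral_const_mul' _ _ ENNReal.ofReal_ne_top,
      lintegral_rpow_mul_one_sub_rpow (by positivity) (by positivity),
      ← ENNReal.ofReal_mul (by positivity), ← ENNReal.ofReal_mul (by positivity)]
    congr 1
    have h1 := Real.Gamma_pos_of_pos (show 0 < p + q + k by positivity)
    rw [hypCoeff, gammaRatio, gammaRatio, show q + k + (p + σ) = p + q + k + σ by ring]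
    have h2 := Real.Gamma_pos_of_pos (show 0 < p + q + k + σ by positivity)
    field_simp
  simp_rw [hterm]
  rw [← lintegral_tsum (fun k => by fun_prop)]
  have hsum : ∀ u ∈ Set.Ioo (0 : ℝ) 1, ∑' k : ℕ, ENNReal.ofReal (1 / Real.Gamma (p + σ)) *
        ENNReal.ofReal (u ^ (q - 1) * (1 - u) ^ (p + σ - 1) *
          (Real.Gamma (p + k) / k.factorial * u ^ k)) =
      ENNReal.ofReal (gammaRatio σ p) *
        ENNReal.ofReal (u ^ (q - 1) * (1 - u) ^ (σ - 1)) := by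
    intro u hu
    have hu1 := hu.1
    have hu' : 0 < 1 - u := sub_pos.2 hu.2
    have hs := (hasSum_Gamma_div_factorial hp hu).mul_left (u ^ (q - 1) * (1 - u) ^ (p + σ - 1))
    rw [ENNReal.tsum_mul_left, ← ENNReal.ofReal_tsum_of_nonneg (fun k => by
      have := Real.Gamma_pos_of_pos (show 0 < (p : ℝ) + k by positivity)
      positivity) hs.summable, hs.tsum_eq, ← ENNReal.ofReal_mul (by positivity),
      ← ENNReal.ofReal_mul (gammaRatio_pos hσ hp').le]
    congr 1
    have : (1 - u) ^ (σ - 1) = (1 - u) ^ (p + σ - 1) * (1 - u) ^ (-(p : ℝ)) := by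
      rw [← Real.rpow_add hu']; congr 1; ring
    rw [this, gammaRatio]
    ring
  rw [setLIntegral_congr_fun measurableSet_Ioo hsum,
    lintegral_const_mul' _ _ ENNReal.ofReal_ne_top, lintegral_rpow_mul_one_sub_rpow hq hσ,
    ← ENNReal.ofReal_mul (gammaRatio_pos hσ hp').le]
  congr 1
  ring

lemma hypCoeff_add_one {p q : ℝ} (hp : 0 < p) (hq : 0 < q) (k : ℕ) :
    hypCoeff p (q + 1) k = (q + k) / (p + q + k) * hypCoeff p q k := by
  rw [hypCoeff, hypCoeff, show q + 1 + k = q + k + 1 by ring,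
    show p + (q + 1) + k = p + q + k + 1 by ring, Real.Gamma_add_one (by positivity),
    Real.Gamma_add_one (by positivity)]
  have := Real.Gamma_pos_of_pos (show 0 < p + q + k by positivity)
  field_simp

lemma hypCoeff_one {p : ℝ} (hp : 0 < p) (k : ℕ) : hypCoeff p 1 k = 1 / (p + k) := by
  rw [hypCoeff, show p + 1 + k = p + k + 1 by ring, Real.Gamma_add_one (by positivity),
    add_comm (1 : ℝ) k, Real.Gamma_nat_eq_factorial]
  have := Real.Gamma_pos_of_pos (show 0 < p + k by positivity)
  field_simp

lemma hypCoeff_le_one {p q : ℕ} (hp : 1 ≤ p) (hq : 1 ≤ q) (k : ℕ) : hypCoeff p q k ≤ 1 := by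
  have hp' : (1 : ℝ) ≤ p := by exact_mod_cast hp
  induction q, hq using Nat.le_induction with
  | base =>
    rw [Nat.cast_one, hypCoeff_one (by positivity), div_le_one (by positivity)]
    linarith [k.cast_nonneg (α := ℝ)]
  | succ q hq ih =>
    rw [Nat.cast_succ, hypCoeff_add_one (by positivity) (by positivity)]
    refine mul_le_one₀ ?_ (hypCoeff_pos (by positivity) (by positivity) k).le ih
    rw [div_le_one (by positivity)]
    linarith

lemma pow_div_le_hypCoeff {p : ℝ} (hp : 0 < p) {q k : ℕ} (hq : 1 ≤ q) (hk : 1 ≤ k) :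
    (k / (k + p)) ^ q / k ≤ hypCoeff p q k := by
  have hk' : (0 : ℝ) < k := by positivity
  induction q, hq using Nat.le_induction with
  | base =>
    rw [Nat.cast_one, hypCoeff_one hp]
    apply le_of_eq
    field_simp
    ring
  | succ q hq ih =>
    have hq' : (0 : ℝ) < q := by positivity
    rw [Nat.cast_succ, hypCoeff_add_one hp hq']
    calc (k / (k + p)) ^ (q + 1) / k = (k / (k + p)) * ((k / (k + p)) ^ q / k) := by ring
      _ ≤ _ := by
        gcongr ?_ * ?_
        rw [div_le_div_iff₀ (by positivity) (by positivity)]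
        nlinarith [mul_pos hp hq']

lemma exp_neg_one_div_le_hypCoeff {p q k : ℕ} (hp : 1 ≤ p) (hq : 1 ≤ q) (hk : p * q ≤ k) :
    Real.exp (-1) / k ≤ hypCoeff p q k := by
  have hk1 : 1 ≤ k := (Nat.mul_pos hp hq).trans_le hk
  have hk' : (0 : ℝ) < k := by positivity
  have hp' : (0 : ℝ) < p := by positivity
  refine le_trans ?_ (pow_div_le_hypCoeff hp' hq hk1)
  gcongr
  have h1 : Real.exp (-(p / k)) ≤ k / (k + p) := by
    have := Real.add_one_le_exp ((p : ℝ) / k)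
    rw [Real.exp_neg, inv_le_comm₀ (Real.exp_pos _) (by positivity), inv_div]
    rwa [add_div, div_self hk'.ne', add_comm]
  calc Real.exp (-1) ≤ Real.exp (-(p / k)) ^ q := by
        rw [← Real.exp_nat_mul, Real.exp_le_exp, mul_neg, neg_le_neg_iff, mul_div_assoc',
          div_le_one hk']
        exact_mod_cast (mul_comm q p).trans_le hk
    _ ≤ _ := by gcongr

lemma hyp2F1_coeff (p q : ℝ) (k : ℕ) :
    (poch p k * poch q k) / (poch (p + q) k * k.factorial) =
      Real.Gamma (p + q) / (Real.Gamma p * Real.Gamma q) * hypCoeff p q k := by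
  rw [poch, poch, poch, hypCoeff, div_mul_div_comm, div_mul_eq_mul_div, div_div_div_eq,
    div_mul_div_comm]
  congr 1
  ring

lemma ofReal_hyp2F1 {p q : ℕ} (hp : 1 ≤ p) (hq : 1 ≤ q) {t : ℝ} (ht : t ∈ Set.Ioo (0 : ℝ) 1) :
    0 ≤ hyp2F1 p q (p + q) t ∧ ENNReal.ofReal (hyp2F1 p q (p + q) t) =
      ENNReal.ofReal (Real.Gamma (p + q) / (Real.Gamma p * Real.Gamma q)) *
        ∑' k : ℕ, ENNReal.ofReal (hypCoeff p q k * t ^ k) := by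
  have hp' : (0 : ℝ) < p := by positivity
  have hq' : (0 : ℝ) < q := by positivity
  have h1 := Real.Gamma_pos_of_pos hp'
  have h2 := Real.Gamma_pos_of_pos hq'
  have h3 := Real.Gamma_pos_of_pos (add_pos hp' hq')
  have ht0 := ht.1
  have hpos : ∀ k, 0 ≤ hypCoeff p q k * t ^ k := fun k =>
    mul_nonneg (hypCoeff_pos hp' hq' k).le (by positivity)
  have hs : Summable fun k : ℕ => hypCoeff p q k * t ^ k :=
    Summable.of_nonneg_of_le hpos
      (fun k => mul_le_of_le_one_left (by positivity) (hypCoeff_le_one hp hq k))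
      (summable_geometric_of_lt_one ht.1.le ht.2)
  have hF : hyp2F1 p q (p + q) t = Real.Gamma (p + q) / (Real.Gamma p * Real.Gamma q) *
      ∑' k : ℕ, hypCoeff p q k * t ^ k := by
    simp_rw [hyp2F1, hyp2F1_coeff, mul_assoc]
    exact tsum_mul_left
  rw [hF, ENNReal.ofReal_mul (by positivity), ENNReal.ofReal_tsum_of_nonneg hpos hs]
  exact ⟨mul_nonneg (by positivity) (tsum_nonneg hpos), rfl⟩

/-- The integral as a double series of beta integrals. -/
lemma lintegral_hyp2F1_sq {s : ℝ} (hs : -1 < s) {p q : ℕ} (hp : 1 ≤ p) (hq : 1 ≤ q) :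
    ∫⁻ t in Set.Ioo (0 : ℝ) 1, ENNReal.ofReal
        (t ^ ((p : ℝ) + q - 1) * (1 - t) ^ s * hyp2F1 p q (p + q) t ^ 2) =
      ENNReal.ofReal ((Real.Gamma (p + q) / (Real.Gamma p * Real.Gamma q)) ^ 2) *
        ∑' k : ℕ, ∑' l : ℕ, ENNReal.ofReal (hypCoeff p q k * hypCoeff p q l *
          (Real.Gamma (s + 1) * gammaRatio (s + 1) (p + q + k + l))) := by
  have hp' : (0 : ℝ) < p := by positivity
  have hq' : (0 : ℝ) < q := by positivity
  have hc := hypCoeff_pos hp' hq'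
  set B := Real.Gamma (p + q) / (Real.Gamma p * Real.Gamma q)
  have hB0 : 0 < B := div_pos (Real.Gamma_pos_of_pos (by positivity))
    (mul_pos (Real.Gamma_pos_of_pos hp') (Real.Gamma_pos_of_pos hq'))
  have hpt : ∀ t ∈ Set.Ioo (0 : ℝ) 1, ENNReal.ofReal
        (t ^ ((p : ℝ) + q - 1) * (1 - t) ^ s * hyp2F1 p q (p + q) t ^ 2) =
      ENNReal.ofReal (B ^ 2) * ∑' k : ℕ, ∑' l : ℕ, ENNReal.ofReal (hypCoeff p q k * hypCoeff p q l) *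
        ENNReal.ofReal (t ^ ((p : ℝ) + q + k + l - 1) * (1 - t) ^ (s + 1 - 1)) := by
    intro t ht
    obtain ⟨h0, h⟩ := ofReal_hyp2F1 hp hq ht
    have ht0 := ht.1
    have ht' : 0 < 1 - t := sub_pos.2 ht.2
    rw [ENNReal.ofReal_mul (by positivity), ENNReal.ofReal_pow h0, h, mul_pow,
      ← ENNReal.ofReal_pow hB0.le, mul_left_comm]
    congr 1
    rw [sq, ← ENNReal.tsum_mul_right, ← ENNReal.tsum_mul_left]
    congr 1 with k
    rw [← ENNReal.tsum_mul_left, ← ENNReal.tsum_mul_left]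
    congr 1 with l
    have hk := hc k
    have hl := hc l
    rw [← ENNReal.ofReal_mul (by positivity), ← ENNReal.ofReal_mul (by positivity),
      ← ENNReal.ofReal_mul (by positivity), add_sub_cancel_right,
      show (p : ℝ) + q + k + l - 1 = p + q - 1 + k + l by ring, Real.rpow_add ht0,
      Real.rpow_add ht0, Real.rpow_natCast, Real.rpow_natCast]
    congr 1
    ring
  rw [setLIntegral_congr_fun measurableSet_Ioo hpt, lintegral_const_mul' _ _ ENNReal.ofReal_ne_top,
    lintegral_tsum (fun k => by fun_prop)]
  congr 2 with k
  rw [lintegral_tsum (fun l => by fun_prop)]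
  congr 1 with l
  have hk := hc k
  have hl := hc l
  rw [lintegral_const_mul' _ _ ENNReal.ofReal_ne_top,
    lintegral_rpow_mul_one_sub_rpow (by positivity) (by linarith),
    ← ENNReal.ofReal_mul (by positivity)]

lemma integral_hyp2F1_sq (s : ℝ) {p q : ℕ} (hp : 1 ≤ p) (hq : 1 ≤ q) :
    ∫ t in Set.Ioo (0 : ℝ) 1, t ^ ((p : ℝ) + q - 1) * (1 - t) ^ s * hyp2F1 p q (p + q) t ^ 2 =
      (∫⁻ t in Set.Ioo (0 : ℝ) 1, ENNReal.ofReal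
        (t ^ ((p : ℝ) + q - 1) * (1 - t) ^ s * hyp2F1 p q (p + q) t ^ 2)).toReal := by
  rw [integral_eq_lintegral_of_nonneg_ae]
  · refine ae_restrict_of_forall_mem measurableSet_Ioo fun t ht => ?_
    have ht0 := ht.1
    have ht' : 0 < 1 - t := sub_pos.2 ht.2
    simp only [Pi.zero_apply]
    positivity
  · have hm : Measurable fun t : ℝ => t ^ ((p : ℝ) + q - 1) * (1 - t) ^ s *
        (ENNReal.ofReal (Real.Gamma (p + q) / (Real.Gamma p * Real.Gamma q)) *
        ∑' k : ℕ, ENNReal.ofReal (hypCoeff p q k * t ^ k)).toReal ^ 2 := by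
      have : Measurable fun t : ℝ => ∑' k : ℕ, ENNReal.ofReal (hypCoeff p q k * t ^ k) :=
        Measurable.tsum fun k => by fun_prop
      fun_prop
    refine hm.aestronglyMeasurable.congr (ae_restrict_of_forall_mem measurableSet_Ioo fun t ht => ?_)
    obtain ⟨h0, h⟩ := ofReal_hyp2F1 hp hq ht
    simp only
    rw [← h, ENNReal.toReal_ofReal h0]

lemma tsum_tsum_hypCoeff_le {σ : ℝ} (hσ : 0 < σ) {p q : ℕ} (hp : 1 ≤ p) (hq : 1 ≤ q) :
    ∑' k : ℕ, ∑' l : ℕ, ENNReal.ofReal (hypCoeff p q k * hypCoeff p q l *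
        (Real.Gamma (2 * σ) * gammaRatio (2 * σ) (p + q + k + l))) ≤
      ENNReal.ofReal (Real.Gamma (2 * σ) *
        (Real.Gamma σ * gammaRatio σ p * gammaRatio σ q) ^ 2) := by
  have hp' : (0 : ℝ) < p := by positivity
  have hq' : (0 : ℝ) < q := by positivity
  have hc := hypCoeff_pos hp' hq'
  have hG := Real.Gamma_pos_of_pos (show 0 < 2 * σ by positivity)
  have hr := gammaRatio_pos hσ hp'
  have hr' := gammaRatio_pos hσ hq'
  have hG' := Real.Gamma_pos_of_pos hσ
  rw [ENNReal.ofReal_mul hG.le, ENNReal.ofReal_pow (by positivity),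
    ← tsum_hypCoeff_mul_gammaRatio hp hq' hσ, sq, ← ENNReal.tsum_mul_right, ← ENNReal.tsum_mul_left]
  refine ENNReal.tsum_le_tsum fun k => ?_
  rw [← ENNReal.tsum_mul_left, ← ENNReal.tsum_mul_left]
  refine ENNReal.tsum_le_tsum fun l => ?_
  have hk := hc k
  have hl := hc l
  have hρk := gammaRatio_pos hσ (show (0 : ℝ) < p + q + k by positivity)
  have hρl := gammaRatio_pos hσ (show (0 : ℝ) < p + q + l by positivity)
  rw [← ENNReal.ofReal_mul (by positivity), ← ENNReal.ofReal_mul hG.le]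
  apply ENNReal.ofReal_le_ofReal
  have h0 := gammaRatio_pos hσ (show (0 : ℝ) < p + q + k + l by positivity)
  have h1 := gammaRatio_two_mul_le_sq (show (0 : ℝ) < p + q + k + l by positivity) hσ
  have h2 := gammaRatio_add_nat_le (show (0 : ℝ) < p + q + k by positivity) hσ l
  have h3 := gammaRatio_add_nat_le (show (0 : ℝ) < p + q + l by positivity) hσ k
  rw [add_right_comm] at h3
  calc _ ≤ hypCoeff p q k * hypCoeff p q l * (Real.Gamma (2 * σ) *
        (gammaRatio σ (p + q + k) * gammaRatio σ (p + q + l))) := by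
        gcongr
        rw [sq] at h1
        exact h1.trans (mul_le_mul h2 h3 h0.le hρk.le)
    _ = _ := by ring

lemma le_tsum_tsum_hypCoeff {τ : ℝ} (hτ : 0 < τ) {p q : ℕ} (hp : 1 ≤ p) (hq : 1 ≤ q) :
    ENNReal.ofReal (Real.exp (-1) ^ 2 / 4 * (Real.Gamma τ * gammaRatio τ (5 * (p * q)))) ≤
      ∑' k : ℕ, ∑' l : ℕ, ENNReal.ofReal (hypCoeff p q k * hypCoeff p q l *
        (Real.Gamma τ * gammaRatio τ (p + q + k + l))) := by
  have hp' : (0 : ℝ) < p := by positivity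
  have hq' : (0 : ℝ) < q := by positivity
  have hG := Real.Gamma_pos_of_pos hτ
  have hN : 1 ≤ p * q := Nat.mul_pos hp hq
  have hN' : (0 : ℝ) < p * q := by positivity
  have hm : p + q ≤ p * q + 1 := by nlinarith
  set x := Real.exp (-1) / (2 * (p * q)) with hx
  have hcoeff : ∀ k ∈ Finset.Ico (p * q) (2 * (p * q)), x ≤ hypCoeff p q k := by
    intro k hk
    rw [Finset.mem_Ico] at hk
    have hk0 : (0 : ℝ) < k := by exact_mod_cast hN.trans hk.1
    refine le_trans ?_ (exp_neg_one_div_le_hypCoeff hp hq hk.1)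
    rw [hx]
    gcongr
    exact_mod_cast hk.2.le
  have hR := gammaRatio_pos hτ (show (0 : ℝ) < 5 * (p * q) by positivity)
  have hpair : ∀ k ∈ Finset.Ico (p * q) (2 * (p * q)), ∀ l ∈ Finset.Ico (p * q) (2 * (p * q)),
      ENNReal.ofReal (x * x * (Real.Gamma τ * gammaRatio τ (5 * (p * q)))) ≤
        ENNReal.ofReal (hypCoeff p q k * hypCoeff p q l *
          (Real.Gamma τ * gammaRatio τ (p + q + k + l))) := by
    intro k hk l hl
    have hk1 := hcoeff k hk
    have hl1 := hcoeff l hl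
    have hx0 : 0 < x := by positivity
    rw [Finset.mem_Ico] at hk hl
    apply ENNReal.ofReal_le_ofReal
    obtain ⟨d, hd⟩ := Nat.exists_eq_add_of_le (show p + q + k + l ≤ 5 * (p * q) by lia)
    have h := gammaRatio_add_nat_le (show (0 : ℝ) < p + q + k + l by positivity) hτ d
    rw [show (p : ℝ) + q + k + l + d = 5 * (p * q) by exact_mod_cast hd.symm] at h
    have hk0 := hx0.trans_le hk1
    have hl0 := hx0.trans_le hl1
    gcongr
  calc ENNReal.ofReal (Real.exp (-1) ^ 2 / 4 * (Real.Gamma τ * gammaRatio τ (5 * (p * q))))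
      = ∑ k ∈ Finset.Ico (p * q) (2 * (p * q)), ∑ l ∈ Finset.Ico (p * q) (2 * (p * q)),
        ENNReal.ofReal (x * x * (Real.Gamma τ * gammaRatio τ (5 * (p * q)))) := by
        rw [Finset.sum_const, Finset.sum_const, Nat.card_Ico, nsmul_eq_mul, nsmul_eq_mul,
          show 2 * (p * q) - p * q = p * q by lia, ← ENNReal.ofReal_natCast,
          ← ENNReal.ofReal_mul (by positivity), ← ENNReal.ofReal_mul (by positivity)]
        congr 1
        rw [hx]
        push_cast
        field_simp
        ring
    _ ≤ ∑ k ∈ Finset.Ico (p * q) (2 * (p * q)), ∑' l : ℕ,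
        ENNReal.ofReal (hypCoeff p q k * hypCoeff p q l *
          (Real.Gamma τ * gammaRatio τ (p + q + k + l))) :=
        Finset.sum_le_sum fun k hk =>
          (Finset.sum_le_sum fun l hl => hpair k hk l hl).trans (ENNReal.sum_le_tsum _)
    _ ≤ _ := ENNReal.sum_le_tsum _

lemma tendsto_rpow_mul_gammaRatio {τ : ℝ} (hτ : 0 < τ) :
    Filter.Tendsto (fun n : ℕ => (n : ℝ) ^ τ * gammaRatio τ n) Filter.atTop (nhds 1) := by
  have hG := Real.Gamma_pos_of_pos hτ
  have hprod : ∀ n : ℕ, (∏ j ∈ Finset.range n, (τ + j)) * Real.Gamma τ = Real.Gamma (n + τ) := by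
    intro n
    induction n with
    | zero => simp
    | succ n ih =>
      rw [Finset.prod_range_succ, mul_right_comm, ih, Nat.cast_succ, add_right_comm,
        Real.Gamma_add_one (by positivity)]
      ring
  have h := (Real.GammaSeq_tendsto_Gamma τ).div_const (Real.Gamma τ)
  rw [div_self hG.ne'] at h
  have h2 : Filter.Tendsto (fun n : ℕ => 1 + τ / n) Filter.atTop (nhds 1) := by
    simpa using (tendsto_const_div_atTop_nhds_zero_nat τ).const_add 1
  have h3 := h.mul h2
  rw [one_mul] at h3
  refine h3.congr' ?_
  filter_upwards [Filter.eventually_ge_atTop 1] with n hn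
  have hn' : (0 : ℝ) < n := by positivity
  have hGn := Real.Gamma_pos_of_pos (show 0 < n + τ by positivity)
  rw [Real.GammaSeq, div_div, hprod, Nat.cast_succ, add_right_comm,
    Real.Gamma_add_one (by positivity), gammaRatio, ← Real.Gamma_nat_eq_factorial,
    Real.Gamma_add_one hn'.ne']
  field_simp

lemma exists_gammaRatio_mul_le {τ : ℝ} (hτ : 0 < τ) :
    ∃ c : ℝ, 0 < c ∧ ∀ p q : ℕ, 1 ≤ p → 1 ≤ q →
      c * (gammaRatio τ p * gammaRatio τ q) ≤ gammaRatio τ (5 * (p * q)) := by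
  have h := tendsto_rpow_mul_gammaRatio hτ
  obtain ⟨C, hC⟩ := h.bddAbove_range
  obtain ⟨D, hD⟩ := (h.inv₀ one_ne_zero).bddAbove_range
  have hC' (n : ℕ) : (n : ℝ) ^ τ * gammaRatio τ n ≤ C := hC ⟨n, rfl⟩
  have hD' (n : ℕ) : ((n : ℝ) ^ τ * gammaRatio τ n)⁻¹ ≤ D := hD ⟨n, rfl⟩
  have hpos : ∀ n : ℕ, 1 ≤ n → 0 < (n : ℝ) ^ τ * gammaRatio τ n := fun n hn =>
    mul_pos (by positivity) (gammaRatio_pos hτ (by positivity))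
  have hC0 : 0 < C := (hpos 1 le_rfl).trans_le (hC' 1)
  have hD0 : 0 < D := (inv_pos.2 (hpos 1 le_rfl)).trans_le (hD' 1)
  refine ⟨(C ^ 2 * D * 5 ^ τ)⁻¹, by positivity, fun p q hp hq => ?_⟩
  have hN : 1 ≤ 5 * (p * q) := by have := Nat.mul_pos hp hq; lia
  have hp' : (0 : ℝ) < p := by positivity
  have hq' : (0 : ℝ) < q := by positivity
  have hd := hD' (5 * (p * q))
  have hdpos := hpos _ hN
  rw [inv_le_comm₀ hdpos hD0] at hd
  push_cast at hd
  rw [Real.mul_rpow (by norm_num) (by positivity), Real.mul_rpow hp'.le hq'.le] at hd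
  have hmul := mul_le_mul (hC' p) (hC' q) (hpos q hq).le hC0.le
  have hpq : 0 < (p : ℝ) ^ τ * (q : ℝ) ^ τ := by positivity
  rw [inv_mul_le_iff₀ (by positivity)]
  rw [inv_le_iff_one_le_mul₀ hD0] at hd
  refine le_of_mul_le_mul_left ?_ hpq
  calc _ = (p : ℝ) ^ τ * gammaRatio τ p * ((q : ℝ) ^ τ * gammaRatio τ q) := by ring
    _ ≤ C * C * 1 := by rw [mul_one]; exact hmul
    _ ≤ C * C * (5 ^ τ * (p ^ τ * q ^ τ) * gammaRatio τ (5 * (p * q)) * D) := by gcongr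
    _ = _ := by ring

/-- The `n = 0` estimate: `I_pqs(0,0) ≍ Γ(p+q)²/(Γ(p)Γ(q)Γ(p+s+1)Γ(q+s+1))`. -/
theorem statement15 (s : ℝ) (hs : -1 < s) :
    ∃ c C : ℝ, 0 < c ∧ c < C ∧ ∀ p q : ℕ, 1 ≤ p → 1 ≤ q →
      c ≤ (∫ t in Set.Ioo (0:ℝ) 1,
            t ^ ((p : ℝ) + q - 1) * (1 - t) ^ s * (hyp2F1 p q ((p : ℝ) + q) t) ^ 2) *
          (Real.Gamma p * Real.Gamma q * Real.Gamma (p + s + 1) * Real.Gamma (q + s + 1)) /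
          Real.Gamma ((p : ℝ) + q) ^ 2 ∧
      (∫ t in Set.Ioo (0:ℝ) 1,
            t ^ ((p : ℝ) + q - 1) * (1 - t) ^ s * (hyp2F1 p q ((p : ℝ) + q) t) ^ 2) *
          (Real.Gamma p * Real.Gamma q * Real.Gamma (p + s + 1) * Real.Gamma (q + s + 1)) /
          Real.Gamma ((p : ℝ) + q) ^ 2 ≤ C := by
  set τ := s + 1 with hτdef
  have hτ : 0 < τ := by linarith
  obtain ⟨σ, hσ2⟩ : ∃ σ, τ = 2 * σ := ⟨τ / 2, by ring⟩
  have hσ : 0 < σ := by linarith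
  obtain ⟨c₀, hc₀, hlow⟩ := exists_gammaRatio_mul_le hτ
  have hGτ := Real.Gamma_pos_of_pos hτ
  set c := Real.exp (-1) ^ 2 / 4 * (Real.Gamma τ * c₀)
  set K := gammaRatio σ 1 ^ 2 / gammaRatio τ 1
  set C := Real.Gamma τ * Real.Gamma σ ^ 2 * K ^ 2
  have hc_pos : 0 < c := by positivity
  refine ⟨c, max C (c + 1), hc_pos, lt_max_of_lt_right (by linarith), fun p q hp hq => ?_⟩
  have hp' : (0 : ℝ) < p := by positivity
  have hq' : (0 : ℝ) < q := by positivity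
  have hGp := Real.Gamma_pos_of_pos hp'
  have hGq := Real.Gamma_pos_of_pos hq'
  have hGpq := Real.Gamma_pos_of_pos (add_pos hp' hq')
  have hGpτ := Real.Gamma_pos_of_pos (add_pos hp' hτ)
  have hGqτ := Real.Gamma_pos_of_pos (add_pos hq' hτ)
  have hRp := gammaRatio_pos hτ hp'
  have hRq := gammaRatio_pos hτ hq'
  set S : ℝ≥0∞ := ∑' k : ℕ, ∑' l : ℕ, ENNReal.ofReal (hypCoeff p q k * hypCoeff p q l *
    (Real.Gamma τ * gammaRatio τ (p + q + k + l))) with hS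
  have hSle : S ≤ ENNReal.ofReal (C * (gammaRatio τ p * gammaRatio τ q)) := by
    have hu := tsum_tsum_hypCoeff_le hσ hp hq
    rw [← hσ2] at hu
    refine hu.trans (ENNReal.ofReal_le_ofReal ?_)
    have h1 := sq_gammaRatio_le hσ hp
    have h2 := sq_gammaRatio_le hσ hq
    rw [← hσ2] at h1 h2
    have := gammaRatio_pos hτ one_pos
    calc _ = Real.Gamma τ * Real.Gamma σ ^ 2 * (gammaRatio σ p ^ 2 * gammaRatio σ q ^ 2) := by ring
      _ ≤ Real.Gamma τ * Real.Gamma σ ^ 2 * (K * gammaRatio τ p * (K * gammaRatio τ q)) := by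
        gcongr
      _ = _ := by ring
  have hleS : ENNReal.ofReal (c * (gammaRatio τ p * gammaRatio τ q)) ≤ S := by
    refine le_trans (ENNReal.ofReal_le_ofReal ?_) (le_tsum_tsum_hypCoeff hτ hp hq)
    calc c * (gammaRatio τ p * gammaRatio τ q) = Real.exp (-1) ^ 2 / 4 *
          (Real.Gamma τ * (c₀ * (gammaRatio τ p * gammaRatio τ q))) := by ring
      _ ≤ _ := by gcongr; exact hlow p q hp hq
  have hStop : S ≠ ⊤ := ne_top_of_le_ne_top ENNReal.ofReal_ne_top hSle
  have hC0 : 0 ≤ C := by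
    have := gammaRatio_pos hτ one_pos
    positivity
  rw [integral_hyp2F1_sq s hp hq, lintegral_hyp2F1_sq hs hp hq, ← hτdef, ← hS, ENNReal.toReal_mul,
    ENNReal.toReal_ofReal (by positivity), add_assoc, add_assoc, ← hτdef]
  have hval : (Real.Gamma (p + q) / (Real.Gamma p * Real.Gamma q)) ^ 2 * S.toReal *
      (Real.Gamma p * Real.Gamma q * Real.Gamma (p + τ) * Real.Gamma (q + τ)) /
        Real.Gamma (p + q) ^ 2 = S.toReal / (gammaRatio τ p * gammaRatio τ q) := by
    rw [gammaRatio, gammaRatio]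
    field_simp
  rw [hval, le_div_iff₀ (by positivity), div_le_iff₀ (by positivity)]
  refine ⟨(ENNReal.ofReal_le_iff_le_toReal hStop).1 hleS,
    (ENNReal.toReal_le_of_le_ofReal (by positivity) hSle).trans ?_⟩
  gcongr
  exact le_max_left _ _
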